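/- arXiv:1810.07715 — 4 statements merged into one kernel-verified Lean document; each statement's English description precedes it below -/
import Mathlib

section
/- Let f, g ∈ F_q[x] with deg f = k ≥ 1 and deg g = D ≥ 2, and suppose the pair (f,g) is neither critical nor p-critical. Let G ∈ F_q[x] be the p-reduction of g and d = deg G > 1. Then there exists a real constant C > 0 such that C·d^n ≤ Δ_{f,g}(n) ≤ k·d^n for all n ≥ 0; in particular Δ_{f,g}(n) grows exponentially in n. -/
open Polynomial UniqueFactorizationMonoid
open scoped Classical

/-- The `n`-th compositional iterate of a polynomial `g`. -/
noncomputable def iterPoly {K : Type*} [CommSemiring K] (g : Polynomial K) : ℕ → Polynomial K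
  | 0 => X
  | n + 1 => g.comp (iterPoly g n)

/-- `P_n[f,g] = f(g^{(n)})`. -/
noncomputable def Pn {K : Type*} [CommSemiring K] (f g : Polynomial K) (n : ℕ) : Polynomial K :=
  f.comp (iterPoly g n)

/-- The finset of (normalized) monic irreducible factors of `P`. -/
noncomputable def irrFactors {K : Type*} [Field K] (P : Polynomial K) : Finset (Polynomial K) :=
  (normalizedFactors P).toFinset

/-- Number of distinct irreducible factors of `P`. -/
noncomputable def Nfac {K : Type*} [Field K] (P : Polynomial K) : ℕ := (irrFactors P).card

/-- Degree of the squarefree part of `P`. -/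
noncomputable def Dfac {K : Type*} [Field K] (P : Polynomial K) : ℕ :=
  ∑ r ∈ irrFactors P, r.natDegree

/-- Largest degree of an irreducible factor of `P`. -/
noncomputable def Mfac {K : Type*} [Field K] (P : Polynomial K) : ℕ :=
  (irrFactors P).sup natDegree

/-- Smallest degree of an irreducible factor of `P`. -/
noncomputable def mfac {K : Type*} [Field K] (P : Polynomial K) : ℕ :=
  sInf {d | ∃ r ∈ irrFactors P, r.natDegree = d}

/-- Largest multiplicity in the irreducible factorization of `P`. -/
noncomputable def Efac {K : Type*} [Field K] (P : Polynomial K) : ℕ :=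
  (irrFactors P).sup fun r => (normalizedFactors P).count r

/-- Smallest multiplicity in the irreducible factorization of `P`. -/
noncomputable def efac {K : Type*} [Field K] (P : Polynomial K) : ℕ :=
  sInf {e | ∃ r ∈ irrFactors P, (normalizedFactors P).count r = e}

/-- Largest multiplicity of a root of `P` in an algebraic closure. -/
noncomputable def nuMax {K : Type*} [Field K] (P : Polynomial K) : ℕ :=
  Efac (P.map (algebraMap K (AlgebraicClosure K)))

/-- Smallest multiplicity of a root of `P` in an algebraic closure. -/
noncomputable def nuMin {K : Type*} [Field K] (P : Polynomial K) : ℕ :=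
  efac (P.map (algebraMap K (AlgebraicClosure K)))

/-- The pair `(f, g)` is `p`-critical: `g = a x^{p^h} + b`. -/
def IsPCritical {K : Type*} [Field K] (p : ℕ) (_f g : Polynomial K) : Prop :=
  ∃ (h : ℕ) (a b : K), g = C a * X ^ p ^ h + C b

/-- The pair `(f, g)` is critical: `f = β (x-α)^{deg f}` and `g = γ (x-α)^{deg g} + α`. -/
def IsCritical {K : Type*} [Field K] (f g : Polynomial K) : Prop :=
  ∃ α β γ : K, f = C β * (X - C α) ^ f.natDegree ∧
    g = C γ * (X - C α) ^ g.natDegree + C α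

section Preimage

variable {L : Type*} [Field L]

/-- The preimage of a finite set under a polynomial map of degree `d` has at most `d` times as
many elements. -/
lemma card_preimage_le {G : L[X]} (hG : 0 < G.natDegree) {T W : Finset L}
    (hTW : ∀ y, y ∈ T ↔ G.eval y ∈ W) : T.card ≤ G.natDegree * W.card := by
  refine Finset.card_le_mul_card_image_of_maps_to (f := fun y => G.eval y)
    (fun y hy => (hTW y).1 hy) _ fun w _ => ?_
  have hne : G - C w ≠ 0 := fun h0 => by
    have := natDegree_sub_C (p := G) (a := w)
    rw [h0, natDegree_zero] at this
    omega
  calc (T.filter fun y => G.eval y = w).card ≤ (G - C w).roots.toFinset.card := by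
        refine Finset.card_le_card fun y hy => ?_
        simp [hne, (Finset.mem_filter.1 hy).2]
    _ ≤ (G - C w).roots.card := Multiset.toFinset_card_le _
    _ ≤ (G - C w).natDegree := card_roots' _
    _ = G.natDegree := natDegree_sub_C

/-- The total ramification of a separable polynomial map of degree `d` is at most `d - 1`. -/
lemma mul_card_le_card_preimage_add [IsAlgClosed L] {G : L[X]} (hG : derivative G ≠ 0)
    {T W : Finset L} (hTW : ∀ y, y ∈ T ↔ G.eval y ∈ W) :
    G.natDegree * W.card ≤ T.card + (G.natDegree - 1) := by
  have fiber : ∀ w ∈ W, G.natDegree ≤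
      ∑ y ∈ T.filter (fun y => G.eval y = w), (1 + (derivative G).rootMultiplicity y) := by
    intro w hw
    have hder : derivative (G - C w) = derivative G := by simp
    have hne : G - C w ≠ 0 := fun h0 => hG (by rw [← hder, h0, derivative_zero])
    have hset : (G - C w).roots.toFinset = T.filter (fun y => G.eval y = w) := by
      ext y
      simp only [Multiset.mem_toFinset, mem_roots hne, IsRoot.def, eval_sub, eval_C, sub_eq_zero,
        Finset.mem_filter, hTW]
      exact ⟨fun h => ⟨h ▸ hw, h⟩, fun h => h.2⟩
    rw [← natDegree_sub_C (p := G) (a := w), (IsAlgClosed.splits (G - C w)).natDegree_eq_card_roots,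
      ← Multiset.toFinset_sum_count_eq, hset]
    refine Finset.sum_le_sum fun y _ => ?_
    have := rootMultiplicity_sub_one_le_derivative_rootMultiplicity_of_ne_zero (G - C w) y
      (by rwa [hder])
    rw [hder] at this
    rw [count_roots]
    omega
  have hram : ∑ y ∈ T, (derivative G).rootMultiplicity y ≤ G.natDegree - 1 := by
    calc ∑ y ∈ T, (derivative G).rootMultiplicity y
        = ∑ y ∈ T, (derivative G).roots.count y := by simp only [count_roots]
      _ ≤ (derivative G).roots.card := by
          rw [← Multiset.toFinset_sum_count_eq]
          exact Finset.sum_le_sum_of_ne_zero fun y _ hy =>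
            Multiset.mem_toFinset.2 (Multiset.count_ne_zero.1 hy)
      _ ≤ (derivative G).natDegree := card_roots' _
      _ ≤ G.natDegree - 1 := natDegree_derivative_le G
  calc G.natDegree * W.card = ∑ _w ∈ W, G.natDegree := by simp [mul_comm]
    _ ≤ ∑ w ∈ W, ∑ y ∈ T.filter (fun y => G.eval y = w),
          (1 + (derivative G).rootMultiplicity y) := Finset.sum_le_sum fiber
    _ = ∑ y ∈ T, (1 + (derivative G).rootMultiplicity y) :=
        Finset.sum_fiberwise_of_maps_to (fun y hy => (hTW y).1 hy) _
    _ = T.card + ∑ y ∈ T, (derivative G).rootMultiplicity y := by simp [Finset.sum_add_distrib]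
    _ ≤ _ := by omega

/-- Untwisting by the inverse of a power of Frobenius turns preimages under `G ^ p ^ h` into
preimages under `G`. -/
lemma exists_untwist (p : ℕ) [Fact p.Prime] [CharP L p] [PerfectRing L p] (G : L[X]) (h : ℕ)
    {T W : Finset L} (hTW : ∀ y, y ∈ T ↔ (G ^ p ^ h).eval y ∈ W) :
    ∃ W' : Finset L, W'.card = W.card ∧ ∀ y, y ∈ T ↔ G.eval y ∈ W' := by
  refine ⟨W.map (iterateFrobeniusEquiv L p h).symm.toEquiv.toEmbedding, Finset.card_map _,
    fun y => ?_⟩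
  rw [hTW, Finset.mem_map_equiv, eval_pow]
  rfl

end Preimage

section SquarefreePart

variable {K : Type*} [Field K]

lemma aeval_radical_eq_zero_iff {L : Type*} [Field L] [Algebra K L] {P : K[X]} (hP : P ≠ 0)
    (x : L) : aeval x (radical P) = 0 ↔ aeval x P = 0 := by
  constructor
  · exact fun hx => aeval_eq_zero_of_dvd_aeval_eq_zero radical_dvd_self hx
  · intro hx
    obtain ⟨n, hn⟩ := exists_dvd_radical_self_pow hP
    have := aeval_eq_zero_of_dvd_aeval_eq_zero hn hx
    rw [map_pow] at this
    exact eq_zero_of_pow_eq_zero this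

lemma natDegree_radical (P : K[X]) : (radical P).natDegree = Dfac P := by
  have hfac : primeFactors P = irrFactors P := by
    rw [irrFactors, ← toFinset_normalizedFactors]
  rw [radical, hfac, natDegree_prod, Dfac]
  · rfl
  · intro r hr
    exact (irreducible_of_normalized_factor r (Multiset.mem_toFinset.1 hr)).ne_zero

/-- Over a perfect field, the squarefree part has as many roots as its degree. -/
lemma Dfac_eq_card_roots [PerfectField K] (L : Type*) [Field L] [Algebra K L] [IsAlgClosed L]
    {P : K[X]} (hP : P ≠ 0) : Dfac P = (P.aroots L).toFinset.card := by
  have hsep : (radical P).Separable := PerfectField.separable_iff_squarefree.2 squarefree_radical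
  rw [← natDegree_radical, ← natDegree_map (algebraMap K L),
    (IsAlgClosed.splits _).natDegree_eq_card_roots,
    ← Multiset.toFinset_card_of_nodup (nodup_roots hsep.map)]
  congr 1
  ext x
  rw [Multiset.mem_toFinset, Multiset.mem_toFinset, ← aroots_def, mem_aroots, mem_aroots,
    aeval_radical_eq_zero_iff hP]
  simp [hP]

lemma exists_root_of_Dfac_eq_one {P : K[X]} (h : Dfac P = 1) : ∃ a, P.IsRoot a := by
  obtain ⟨a, ha⟩ := exists_root_of_degree_eq_one
    (degree_eq_iff_natDegree_eq_of_pos one_pos |>.2 ((natDegree_radical P).trans h))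
  exact ⟨a, ha.dvd radical_dvd_self⟩

/-- A polynomial with a single root is a multiple of a power of a linear polynomial. -/
lemma eq_C_mul_X_sub_C_pow (L : Type*) [Field L] [Algebra K L] [IsAlgClosed L] {P : K[X]} {a : K}
    (h : ∀ x : L, aeval x P = 0 → x = algebraMap K L a) :
    P = C P.leadingCoeff * (X - C a) ^ P.natDegree := by
  by_cases hP : P = 0
  · simp [hP]
  have hs : (P.map (algebraMap K L)).Splits := IsAlgClosed.splits _
  have hroots : (P.map (algebraMap K L)).roots =
      Multiset.replicate P.natDegree (algebraMap K L a) := by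
    rw [Multiset.eq_replicate]
    refine ⟨by rw [← hs.natDegree_eq_card_roots, natDegree_map], fun x hx => h x ?_⟩
    exact (mem_aroots.1 hx).2
  apply map_injective _ (algebraMap K L).injective
  conv_lhs => rw [hs.eq_prod_roots, hroots]
  simp

end SquarefreePart

section Iterates

variable {K : Type*} [Field K]

lemma natDegree_iterPoly (g : K[X]) (n : ℕ) : (iterPoly g n).natDegree = g.natDegree ^ n := by
  induction n with
  | zero => simp [iterPoly]
  | succ n ih => rw [iterPoly, natDegree_comp, ih, pow_succ']

lemma iterPoly_succ_comp (g : K[X]) (n : ℕ) : iterPoly g (n + 1) = (iterPoly g n).comp g := by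
  induction n with
  | zero => simp [iterPoly]
  | succ n ih =>
    calc iterPoly g (n + 2) = g.comp ((iterPoly g n).comp g) := by rw [← ih]; rfl
      _ = (iterPoly g (n + 1)).comp g := by rw [← comp_assoc]; rfl

lemma Pn_succ_comp (f g : K[X]) (n : ℕ) : Pn f g (n + 1) = (Pn f g n).comp g := by
  rw [Pn, iterPoly_succ_comp, ← comp_assoc, Pn]

lemma natDegree_Pn_pos {f g : K[X]} (hf : 0 < f.natDegree) (hg : 0 < g.natDegree) (n : ℕ) :
    0 < (Pn f g n).natDegree := by
  rw [Pn, natDegree_comp, natDegree_iterPoly]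
  positivity

end Iterates

theorem stmt2 {K : Type*} [Field K] [Fintype K] {p : ℕ} [Fact p.Prime] [CharP K p]
    (f g G : Polynomial K) (h k D d : ℕ)
    (hfk : f.natDegree = k) (hk : 1 ≤ k)
    (hgD : g.natDegree = D) (hD : 2 ≤ D)
    (hcrit : ¬ IsCritical f g) (hpcrit : ¬ IsPCritical p f g)
    (hred : g = G ^ p ^ h) (hG : derivative G ≠ 0)
    (hd : G.natDegree = d) (hd1 : 1 < d) :
    ∃ c : ℝ, 0 < c ∧ ∀ n : ℕ,
      c * (d : ℝ) ^ n ≤ (Dfac (Pn f g n) : ℝ) ∧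
      (Dfac (Pn f g n) : ℝ) ≤ (k : ℝ) * (d : ℝ) ^ n := by
  classical
  let L := AlgebraicClosure K
  have : CharP L p := charP_of_injective_algebraMap (algebraMap K L).injective p
  have hg0 : 0 < g.natDegree := by omega
  have hPpos := natDegree_Pn_pos (hfk ▸ hk : 0 < f.natDegree) hg0
  have hP0 : ∀ n, Pn f g n ≠ 0 := fun n => ne_zero_of_natDegree_gt (hPpos n)
  let S : ℕ → Finset L := fun n => ((Pn f g n).aroots L).toFinset
  have hDS : ∀ n, Dfac (Pn f g n) = (S n).card := fun n => Dfac_eq_card_roots L (hP0 n)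
  have hmem : ∀ n x, x ∈ S n ↔ aeval x (Pn f g n) = 0 := fun n x => by
    simp [S, hP0 n]
  let Gbar := G.map (algebraMap K L)
  have hGLd : Gbar.natDegree = d := by rw [natDegree_map, hd]
  have hGLder : derivative Gbar ≠ 0 := by
    rw [derivative_map]
    exact (Polynomial.map_ne_zero_iff (algebraMap K L).injective).2 hG
  have hgL : ∀ y : L, aeval y g = (Gbar ^ p ^ h).eval y := fun y => by
    rw [hred, ← Polynomial.map_pow, eval_map_algebraMap]
  have upper : ∀ T W : Finset L, (∀ y, y ∈ T ↔ aeval y g ∈ W) → T.card ≤ d * W.card := by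
    intro T W hTW
    obtain ⟨W', hW', hT⟩ := exists_untwist p Gbar h (fun y => by rw [hTW, hgL])
    rw [← hW', ← hGLd]
    exact card_preimage_le (by omega) hT
  have lower : ∀ T W : Finset L, (∀ y, y ∈ T ↔ aeval y g ∈ W) →
      d * W.card ≤ T.card + (d - 1) := by
    intro T W hTW
    obtain ⟨W', hW', hT⟩ := exists_untwist p Gbar h (fun y => by rw [hTW, hgL])
    rw [← hW', ← hGLd]
    exact mul_card_le_card_preimage_add hGLder hT
  have hstep : ∀ n y, y ∈ S (n + 1) ↔ aeval y g ∈ S n := fun n y => by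
    rw [hmem, hmem, Pn_succ_comp, aeval_comp]
  have hpos : ∀ n, 1 ≤ (S n).card := by
    intro n
    obtain ⟨x, hx⟩ := IsAlgClosed.exists_aeval_eq_zero L (Pn f g n)
      (natDegree_pos_iff_degree_pos.1 (hPpos n)).ne'
    exact Finset.card_pos.2 ⟨x, (hmem n x).2 hx⟩
  have htwo : ∃ m, 2 ≤ (S m).card := by
    by_contra! hlt
    have hone : ∀ n, ∃ x, S n = {x} := fun n =>
      Finset.card_eq_one.1 (by have := hpos n; have := hlt n; omega)
    obtain ⟨a, ha⟩ : ∃ a, f.IsRoot a := by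
      apply exists_root_of_Dfac_eq_one
      have h0 := hDS 0
      obtain ⟨x, hx⟩ := hone 0
      rw [hx, Finset.card_singleton] at h0
      simpa [Pn, iterPoly] using h0
    have hS0 : S 0 = {algebraMap K L a} := by
      obtain ⟨x, hx⟩ := hone 0
      have : algebraMap K L a ∈ S 0 := by
        rw [hmem]
        simp [Pn, iterPoly, aeval_algebraMap_apply, ha.eq_zero]
      rw [hx, Finset.mem_singleton] at this
      rw [hx, this]
    obtain ⟨x, hx⟩ := hone 1
    obtain ⟨z, hz⟩ := hone 2
    have hxa : x = algebraMap K L a := by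
      by_contra hne
      have hcount := lower (S 1 ∪ S 2) (S 0 ∪ S 1) fun y => by
        rw [Finset.mem_union, Finset.mem_union, hstep 0, hstep 1]
      have hW : (S 0 ∪ S 1).card = 2 := by
        rw [hS0, hx]
        exact Finset.card_pair (Ne.symm hne)
      have hT : (S 1 ∪ S 2).card ≤ 2 := by
        rw [hx, hz]
        exact Finset.card_le_two
      rw [hW] at hcount
      omega
    subst hxa
    refine hcrit ⟨a, f.leadingCoeff, (g - C a).leadingCoeff, eq_C_mul_X_sub_C_pow L ?_, ?_⟩
    · intro y hy
      rw [← Finset.mem_singleton, ← hS0, hmem]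
      simpa [Pn, iterPoly] using hy
    · rw [← sub_eq_iff_eq_add, ← natDegree_sub_C (p := g) (a := a)]
      apply eq_C_mul_X_sub_C_pow L
      intro y hy
      rw [← Finset.mem_singleton, ← hx, hstep, hS0, Finset.mem_singleton, ← sub_eq_zero]
      simpa using hy
  obtain ⟨m, hm⟩ := htwo
  have hgrow : ∀ n, d ^ n + 1 ≤ (S (m + n)).card := by
    intro n
    induction n with
    | zero => simpa using hm
    | succ n ih =>
      have h1 := lower _ _ (hstep (m + n))
      have h2 := Nat.mul_le_mul_left d ih
      rw [mul_add, mul_one, ← pow_succ'] at h2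
      change _ ≤ (S (m + n + 1)).card
      omega
  have hlow : ∀ n, d ^ n ≤ d ^ m * (S n).card := by
    intro n
    rcases le_total m n with hmn | hmn
    · obtain ⟨j, rfl⟩ := Nat.exists_eq_add_of_le hmn
      rw [pow_add]
      exact Nat.mul_le_mul_left _ ((Nat.le_succ _).trans (hgrow j))
    · calc d ^ n ≤ d ^ m := Nat.pow_le_pow_right (by omega) hmn
        _ ≤ d ^ m * (S n).card := Nat.le_mul_of_pos_right _ (hpos n)
  have hup : ∀ n, (S n).card ≤ k * d ^ n := by
    intro n
    induction n with
    | zero =>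
      have hP : Pn f g 0 = f := by simp [Pn, iterPoly]
      calc (S 0).card ≤ ((Pn f g 0).aroots L).card := Multiset.toFinset_card_le _
        _ ≤ ((Pn f g 0).map (algebraMap K L)).natDegree := card_roots' _
        _ = k * d ^ 0 := by rw [natDegree_map, hP, hfk, pow_zero, mul_one]
    | succ n ih =>
      calc (S (n + 1)).card ≤ d * (S n).card := upper _ _ (hstep n)
        _ ≤ d * (k * d ^ n) := Nat.mul_le_mul_left _ ih
        _ = k * d ^ (n + 1) := by ring
  have hdm : (0 : ℝ) < (d : ℝ) ^ m := pow_pos (by exact_mod_cast (by omega : 0 < d)) _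
  refine ⟨((d : ℝ) ^ m)⁻¹, inv_pos.2 hdm, fun n => ?_⟩
  rw [hDS]
  constructor
  · rw [inv_mul_le_iff₀ hdm]
    exact_mod_cast hlow n
  · exact_mod_cast hup n
end

section
/- Let f, g ∈ F_q[x] with deg f = k ≥ 1 and deg g = D ≥ 2, and suppose the pair (f,g) is neither critical nor p-critical. Then there exists a real constant c > 0 such that M_{f,g}(n) ≥ c·n for all n ≥ 0. -/
open Polynomial UniqueFactorizationMonoid
open scoped Classical

theorem Pn_succ_eq_comp {K : Type*} [CommSemiring K] (f g : Polynomial K) (n : ℕ) :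
    Pn f g (n + 1) = (Pn f g n).comp g := by
  have h : ∀ n, iterPoly g (n + 1) = (iterPoly g n).comp g := by
    intro n
    induction n with
    | zero => simp [iterPoly]
    | succ n ih =>
      change g.comp (iterPoly g (n + 1)) = (g.comp (iterPoly g n)).comp g
      rw [ih, comp_assoc]
  rw [Pn, h, ← comp_assoc]
  rfl

theorem natDegree_Pn {K : Type*} [Field K] (f g : Polynomial K) (n : ℕ) :
    (Pn f g n).natDegree = f.natDegree * g.natDegree ^ n := by
  induction n with
  | zero => simp [Pn, iterPoly]
  | succ n ih => rw [Pn_succ_eq_comp, natDegree_comp, ih, pow_succ, mul_assoc]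

/-- Over an algebraically closed field, a polynomial map with nonzero derivative has many distinct
preimages: at most `natDegree h - 1` of them are lost to ramification. -/
theorem natDegree_mul_card_le_card_preimage {L : Type*} [Field L] [IsAlgClosed L]
    (h : L[X]) (hd : derivative h ≠ 0) (S T : Finset L) (hT : ∀ x, h.eval x ∈ S → x ∈ T) :
    h.natDegree * S.card + 1 ≤ T.card + h.natDegree := by
  have hpos : 0 < h.natDegree := by
    rw [Nat.pos_iff_ne_zero]
    intro h0
    exact hd (derivative_of_natDegree_zero h0)
  have hfib : ∀ s ∈ S, h.natDegree ≤
      (T.filter (fun x => h.eval x = s)).card +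
        ∑ x ∈ T.filter (fun x => h.eval x = s), (derivative h).rootMultiplicity x := by
    intro s hs
    have hne : h - C s ≠ 0 := by
      intro h0
      apply hd
      rw [sub_eq_zero.mp h0, derivative_C]
    have hsub : (h - C s).roots.toFinset ⊆ T.filter (fun x => h.eval x = s) := by
      intro x hx
      rw [Multiset.mem_toFinset, mem_roots hne] at hx
      have hx' : h.eval x = s := by simpa [sub_eq_zero] using hx
      exact Finset.mem_filter.mpr ⟨hT x (hx' ▸ hs), hx'⟩
    have hcard : (h - C s).roots.card = h.natDegree := by
      rw [← (IsAlgClosed.splits (h - C s)).natDegree_eq_card_roots, natDegree_sub_C]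
    rw [← hcard, ← Multiset.sum_count_eq_card (s := T.filter (fun x => h.eval x = s))
      (fun x hx => hsub (Multiset.mem_toFinset.mpr hx)), Finset.card_eq_sum_ones,
      ← Finset.sum_add_distrib]
    refine Finset.sum_le_sum fun x _ => ?_
    have hder : derivative (h - C s) = derivative h := by simp
    have := rootMultiplicity_sub_one_le_derivative_rootMultiplicity_of_ne_zero (h - C s) x
      (by rwa [hder])
    rw [hder] at this
    rw [count_roots]
    omega
  have hsum : ∀ φ : L → ℕ, ∑ s ∈ S, ∑ x ∈ T.filter (fun x => h.eval x = s), φ x ≤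
      ∑ x ∈ T, φ x := fun φ => Finset.sum_fiberwise_le_sum_of_sum_fiber_nonneg
        (fun _ _ => Nat.zero_le _)
  have h1 : h.natDegree * S.card ≤ T.card + ∑ x ∈ T, (derivative h).rootMultiplicity x := by
    calc h.natDegree * S.card = ∑ s ∈ S, h.natDegree := by simp [mul_comm]
      _ ≤ _ := Finset.sum_le_sum hfib
      _ ≤ _ := by
        rw [Finset.sum_add_distrib]
        refine add_le_add ?_ (hsum _)
        simpa only [Finset.card_eq_sum_ones] using hsum (fun _ => 1)
  have h2 : ∑ x ∈ T, (derivative h).rootMultiplicity x ≤ (derivative h).natDegree := by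
    refine le_trans ?_ (card_roots' (derivative h))
    simp_rw [← count_roots]
    rw [← Multiset.toFinset_sum_count_eq]
    refine (Finset.sum_le_sum_of_ne_zero fun x _ hx => ?_)
    exact Multiset.mem_toFinset.mpr (Multiset.count_ne_zero.mp hx)
  have h3 := natDegree_derivative_lt hpos.ne'
  omega

/-- Unless `g` is of the form `a x^{p^h} + b`, taking preimages under `g` nearly doubles the size
of a finite set. -/
theorem two_mul_card_le_card_preimage {K L : Type*} [Field K] [Finite K] [Field L] [Algebra K L]
    [IsAlgClosed L] {p : ℕ} [Fact p.Prime] [CharP K p] (f g : K[X]) (hg : ¬ IsPCritical p f g)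
    (S T : Finset L) (hS : S.Nonempty) (hT : ∀ x, aeval x g ∈ S → x ∈ T) :
    2 * S.card ≤ T.card + 1 := by
  induction hn : g.natDegree using Nat.strong_induction_on generalizing g S with
  | _ n ih =>
  subst hn
  have : CharP L p := charP_of_injective_algebraMap (algebraMap K L).injective p
  have hdeg : 2 ≤ g.natDegree := by
    by_contra! hlt
    obtain ⟨a, b, rfl⟩ := exists_eq_X_add_C_of_natDegree_le_one (Nat.lt_succ_iff.mp hlt)
    exact hg ⟨0, a, b, by simp⟩
  by_cases hd : derivative g = 0
  · obtain ⟨h, rfl⟩ : ∃ h : K[X], g = h ^ p := by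
      refine ⟨(contract p g).map (frobeniusEquiv K p).symm, ?_⟩
      exact (expand_contract p hd (Fact.out : p.Prime).ne_zero).symm.trans
        (polynomial_expand_eq K p _)
    have hp := (Fact.out : p.Prime).two_le
    rw [natDegree_pow] at ih hdeg
    have himg : (S.image (frobeniusEquiv L p).symm).card = S.card :=
      Finset.card_image_of_injective _ (frobeniusEquiv L p).symm.injective
    rw [← himg]
    have hpos : 0 < h.natDegree := Nat.pos_of_ne_zero fun h0 => by simp [h0] at hdeg
    refine ih h.natDegree (by nlinarith) h ?_ _ (hS.image _) ?_ rfl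
    · rintro ⟨j, a, b, rfl⟩
      refine hg ⟨j + 1, a ^ p, b ^ p, ?_⟩
      rw [add_pow_char, mul_pow, ← pow_mul, ← pow_succ, C_pow, C_pow]
    · intro x hx
      obtain ⟨s, hs, hsx⟩ := Finset.mem_image.mp hx
      refine hT x ?_
      rw [map_pow, ← hsx]
      simpa using hs
  · have key := natDegree_mul_card_le_card_preimage (g.map (algebraMap K L))
      (by rwa [derivative_map, Ne, Polynomial.map_eq_zero]) S T
      (fun x hx => hT x (by rwa [eval_map_algebraMap] at hx))
    rw [natDegree_map] at key
    have := hS.card_pos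
    obtain ⟨c, hc⟩ := Nat.exists_eq_add_of_le hdeg
    obtain ⟨m, hm⟩ := Nat.exists_eq_add_of_le this
    rw [hc, hm] at key
    rw [hm]
    nlinarith [Nat.zero_le (c * m)]

/-- A polynomial over a perfect field all of whose geometric roots are equal to the image of `a`
is a multiple of a power of `X - a`. -/
theorem eq_C_mul_X_sub_C_pow_of_unique_root {K L : Type*} [Field K] [Field L] [Algebra K L]
    [IsAlgClosed L] (h : K[X]) (hne : h ≠ 0) (a : K)
    (ha : ∀ x : L, aeval x h = 0 → x = algebraMap K L a) :
    h = C h.leadingCoeff * (X - C a) ^ h.natDegree := by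
  apply map_injective _ (algebraMap K L).injective
  have hs := IsAlgClosed.splits (h.map (algebraMap K L))
  have hr : (h.map (algebraMap K L)).roots =
      Multiset.replicate h.natDegree (algebraMap K L a) := by
    rw [Multiset.eq_replicate]
    refine ⟨by rw [← hs.natDegree_eq_card_roots, natDegree_map], fun x hx => ha x ?_⟩
    rw [mem_roots (by rwa [Ne, Polynomial.map_eq_zero]), IsRoot, eval_map_algebraMap] at hx
    exact hx
  conv_lhs => rw [hs.eq_prod_roots, hr]
  simp

/-- A polynomial has at most `q ^ (2 M + 1)` distinct geometric roots, where `M` bounds the degree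
of its irreducible factors over the field with `q` elements. -/
theorem card_roots_toFinset_le {K L : Type*} [Field K] [Fintype K] [Field L] [Algebra K L]
    (P : K[X]) :
    (P.map (algebraMap K L)).roots.toFinset.card ≤ Fintype.card K ^ (2 * Mfac P + 1) := by
  rcases eq_or_ne P 0 with rfl | hP
  · simp
  have hsub : (P.map (algebraMap K L)).roots.toFinset ⊆
      (irrFactors P).biUnion fun r => (r.map (algebraMap K L)).roots.toFinset := by
    intro x hx
    rw [Multiset.mem_toFinset, mem_roots (by rwa [Ne, Polynomial.map_eq_zero]), IsRoot,
      eval_map_algebraMap] at hx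
    have hint : IsIntegral K x := (isAlgebraic_iff_isIntegral.mp ⟨P, hP, hx⟩)
    obtain ⟨r, hr, hrx⟩ := exists_mem_normalizedFactors_of_dvd hP (minpoly.irreducible hint)
      (minpoly.dvd K x hx)
    refine Finset.mem_biUnion.mpr ⟨r, Multiset.mem_toFinset.mpr hr, ?_⟩
    have hr0 : r ≠ 0 := (irreducible_of_normalized_factor r hr).ne_zero
    rw [Multiset.mem_toFinset, mem_roots (by rwa [Ne, Polynomial.map_eq_zero]), IsRoot,
      eval_map_algebraMap]
    exact aeval_eq_zero_of_dvd_aeval_eq_zero hrx.dvd (minpoly.aeval K x)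
  have hdeg : ∀ r ∈ irrFactors P, r.natDegree ≤ Mfac P := fun r hr =>
    Finset.le_sup (f := natDegree) hr
  have hcard : (irrFactors P).card ≤ Fintype.card K ^ (Mfac P + 1) := by
    have hinj : Set.InjOn (fun (r : K[X]) (i : Fin (Mfac P + 1)) => r.coeff i)
        (irrFactors P : Set K[X]) := by
      intro r hr s hs hrs
      ext i
      rcases lt_or_ge i (Mfac P + 1) with hi | hi
      · exact congrFun hrs ⟨i, hi⟩
      · rw [coeff_eq_zero_of_natDegree_lt ((hdeg r hr).trans_lt hi),
          coeff_eq_zero_of_natDegree_lt ((hdeg s hs).trans_lt hi)]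
    have := Finset.card_le_card_of_injOn (t := Finset.univ) _ (fun _ _ => Finset.mem_univ _) hinj
    simpa using this
  calc _ ≤ _ := Finset.card_le_card hsub
    _ ≤ (irrFactors P).card * Mfac P := by
      refine Finset.card_biUnion_le_card_mul _ _ _ fun r hr => ?_
      refine (Multiset.toFinset_card_le _).trans ((card_roots' _).trans ?_)
      rw [natDegree_map]
      exact hdeg r hr
    _ ≤ Fintype.card K ^ (Mfac P + 1) * Fintype.card K ^ Mfac P :=
      Nat.mul_le_mul hcard (Nat.lt_pow_self Fintype.one_lt_card).le
    _ = _ := by rw [← pow_add]; congr 1; ring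

/-- An element of an algebraic closure of a perfect field which is the only root of a polynomial
lies in the base field. -/
theorem mem_range_algebraMap_of_unique_root {K : Type*} [Field K] [PerfectField K] (f : K[X])
    (α : AlgebraicClosure K) (hα : aeval α f = 0)
    (huniq : ∀ x : AlgebraicClosure K, aeval x f = 0 → x = α) :
    ∃ a : K, algebraMap K (AlgebraicClosure K) a = α := by
  have : IsGalois K (AlgebraicClosure K) := {}
  have h := (InfiniteGalois.mem_bot_iff_fixed (k := K) α).mpr fun σ => huniq _ (by
    rw [← AlgEquiv.coe_toAlgHom, aeval_algHom_apply, hα, map_zero])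
  exact IntermediateField.mem_bot.mp h

theorem one_le_Mfac {K : Type*} [Field K] (P : K[X]) (hP : 0 < P.natDegree) : 1 ≤ Mfac P := by
  have hP0 : P ≠ 0 := by rintro rfl; simp at hP
  obtain ⟨r, hr⟩ := exists_mem_normalizedFactors hP0
    (fun hu => hP.ne' (natDegree_eq_zero_of_isUnit hu))
  exact ((irreducible_of_normalized_factor r hr).natDegree_pos).trans_le
    (Finset.le_sup (f := natDegree) (Multiset.mem_toFinset.mpr hr))

/-- If `(f, g)` is neither critical nor `p`-critical, then the number of distinct geometric roots
of `P_n[f,g]` grows exponentially. -/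
theorem two_pow_lt_card_roots_Pn {K : Type*} [Field K] [Finite K] {p : ℕ} [Fact p.Prime]
    [CharP K p] (f g : K[X]) (hf : 1 ≤ f.natDegree) (hg : 1 ≤ g.natDegree)
    (hcrit : ¬ IsCritical f g) (hpcrit : ¬ IsPCritical p f g) (n : ℕ) :
    2 ^ n < ((Pn f g (n + 2)).map (algebraMap K (AlgebraicClosure K))).roots.toFinset.card := by
  set R : ℕ → Finset (AlgebraicClosure K) := fun n =>
    ((Pn f g n).map (algebraMap K (AlgebraicClosure K))).roots.toFinset with hR
  have hmem : ∀ n x, x ∈ R n ↔ aeval x (Pn f g n) = 0 := by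
    intro n x
    have hpos : 0 < (Pn f g n).natDegree := by rw [natDegree_Pn]; positivity
    have hne : Pn f g n ≠ 0 := by rintro h; simp [h] at hpos
    rw [hR, Multiset.mem_toFinset, mem_roots (by rwa [Ne, Polynomial.map_eq_zero]), IsRoot,
      eval_map_algebraMap]
  have hne : ∀ n, (R n).Nonempty := by
    intro n
    have hpos : 0 < (Pn f g n).natDegree := by rw [natDegree_Pn]; positivity
    obtain ⟨x, hx⟩ := IsAlgClosed.exists_aeval_eq_zero (AlgebraicClosure K) (Pn f g n)
      (natDegree_pos_iff_degree_pos.mp hpos).ne'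
    exact ⟨x, (hmem n x).mpr hx⟩
  have hsucc : ∀ n x, x ∈ R (n + 1) ↔ aeval x g ∈ R n := by
    intro n x
    rw [hmem, hmem, Pn_succ_eq_comp, aeval_comp]
  have hstep : ∀ n, 2 * (R n).card ≤ (R (n + 1)).card + 1 := fun n =>
    two_mul_card_le_card_preimage f g hpcrit _ _ (hne n) fun x hx => (hsucc n x).mpr hx
  have h2 : 1 < (R 2).card := by
    by_contra! hle
    have hs1 : 2 * (R 1).card ≤ (R 2).card + 1 := hstep 1
    have hs0 : 2 * (R 0).card ≤ (R 1).card + 1 := hstep 0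
    have hp0 := (hne 0).card_pos
    have hp1 := (hne 1).card_pos
    obtain ⟨α, hα⟩ := Finset.card_eq_one.mp (by omega : (R 0).card = 1)
    obtain ⟨β, hβ⟩ := Finset.card_eq_one.mp (by omega : (R 1).card = 1)
    have hαβ : α = β := by
      by_contra hab
      have := two_mul_card_le_card_preimage f g hpcrit (R 0 ∪ R 1) (R 1 ∪ R 2)
        ((hne 0).mono Finset.subset_union_left) (by
          intro x hx
          rw [Finset.mem_union, ← hsucc, ← hsucc] at hx
          exact Finset.mem_union.mpr hx)
      have h01 : (R 0 ∪ R 1).card = 2 := by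
        rw [hα, hβ]; exact Finset.card_pair hab
      have := Finset.card_union_le (R 1) (R 2)
      omega
    subst hαβ
    have hf0 : Pn f g 0 = f := by simp [Pn, iterPoly]
    have hfα : ∀ x, aeval x f = 0 ↔ x = α := by
      intro x
      rw [← hf0, ← hmem, hα, Finset.mem_singleton]
    obtain ⟨a, rfl⟩ := mem_range_algebraMap_of_unique_root f α ((hfα α).mpr rfl)
      fun x hx => (hfα x).mp hx
    have hgC : g - C a ≠ 0 := by
      intro h0
      rw [sub_eq_zero.mp h0, natDegree_C] at hg
      omega
    refine hcrit ⟨a, f.leadingCoeff, (g - C a).leadingCoeff,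
      eq_C_mul_X_sub_C_pow_of_unique_root (L := AlgebraicClosure K) f (by rintro rfl; simp at hf) a
        fun x hx => (hfα x).mp hx, ?_⟩
    rw [← natDegree_sub_C (a := a), ← sub_eq_iff_eq_add]
    refine eq_C_mul_X_sub_C_pow_of_unique_root (L := AlgebraicClosure K) _ hgC a fun x hx => ?_
    rw [← Finset.mem_singleton, ← hβ, hsucc, hα, Finset.mem_singleton]
    simpa [sub_eq_zero] using hx
  change 2 ^ n < (R (n + 2)).card
  induction n with
  | zero => simpa using h2
  | succ n ih =>
    have := hstep (n + 2)
    rw [show n + 1 + 2 = n + 2 + 1 by ring, pow_succ]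
    omega

theorem stmt4 {K : Type*} [Field K] [Fintype K] {p : ℕ} [Fact p.Prime] [CharP K p]
    (f g : Polynomial K) (k D : ℕ)
    (hfk : f.natDegree = k) (hk : 1 ≤ k)
    (hgD : g.natDegree = D) (hD : 2 ≤ D)
    (hcrit : ¬ IsCritical f g) (hpcrit : ¬ IsPCritical p f g) :
    ∃ c : ℝ, 0 < c ∧ ∀ n : ℕ, c * (n : ℝ) ≤ (Mfac (Pn f g n) : ℝ) := by
  subst hfk hgD
  have hq : 2 ≤ Fintype.card K := Fintype.one_lt_card
  refine ⟨1 / (5 * Fintype.card K), by positivity, fun n => ?_⟩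
  suffices h : n ≤ 5 * Fintype.card K * Mfac (Pn f g n) by
    rw [one_div_mul_eq_div, div_le_iff₀ (by positivity), mul_comm]
    exact_mod_cast h
  have hM : 1 ≤ Mfac (Pn f g n) := one_le_Mfac _ (by rw [natDegree_Pn]; positivity)
  rcases lt_or_ge n 2 with hn | hn
  · nlinarith
  obtain ⟨m, rfl⟩ := Nat.exists_eq_add_of_le' hn
  have hlt := (two_pow_lt_card_roots_Pn f g hk (by omega) hcrit hpcrit m).trans_le
    (card_roots_toFinset_le (Pn f g (m + 2)))
  set M := Mfac (Pn f g (m + 2))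
  have hpow : 2 ^ m < 2 ^ (Fintype.card K * (2 * M + 1)) := by
    refine hlt.trans_le ?_
    rw [pow_mul]
    exact Nat.pow_le_pow_left Nat.lt_two_pow_self.le _
  have := (Nat.pow_lt_pow_iff_right (by norm_num : 1 < 2)).mp hpow
  nlinarith
end

section
/- Let q > 2 be a prime power and suppose f ∈ F_q[x] can be written as f(x) = x^k·F(x) with k ≥ 0, where F(x) = x^m + Σ_{i=0}^{m−1} a_i x^i is monic of degree m ≥ 1 and a₀ ∉ {0, 1}. Then there exists a polynomial g ∈ F_q[x] of degree at least 2 and a real constant c > 0 such that M_{f,g}(n) ≥ c·2^n and N_{f,g}(n) ≥ c·2^n for all n ≥ 0. -/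
open Polynomial UniqueFactorizationMonoid
open scoped Classical

/-- Monic irreducible polynomials of even degree with constant term outside `{0, 1}`. -/
structure IsEvenNonOne {K : Type*} [Field K] (r : K[X]) : Prop where
  monic : r.Monic
  irreducible : Irreducible r
  even : Even r.natDegree
  coeff_ne_zero : r.coeff 0 ≠ 0
  coeff_ne_one : r.coeff 0 ≠ 1

open IntermediateField in
theorem norm_eq_coeff_zero_minpoly_pow {K E : Type*} [Field K] [Field E] [Algebra K E]
    [FiniteDimensional K E] (x : E) :
    Algebra.norm K x =
      ((-1) ^ (minpoly K x).natDegree * (minpoly K x).coeff 0) ^ Module.finrank K⟮x⟯ E := by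
  have hx : IsIntegral K x := .of_finite K x
  rw [Algebra.norm_eq_norm_adjoin, ← adjoin.powerBasis_gen hx,
    Algebra.PowerBasis.norm_gen_eq_coeff_zero_minpoly, adjoin.powerBasis_gen,
    adjoin.powerBasis_dim, minpoly_gen]

theorem finrank_adjoinRoot {K : Type*} [Field K] {w : K[X]} (hw : w ≠ 0) :
    Module.finrank K (AdjoinRoot w) = w.natDegree := by
  rw [(AdjoinRoot.powerBasis hw).finrank, AdjoinRoot.powerBasis_dim]

/-- If `w` divides `r ∘ h`, then `h` evaluated at the root of `w` has minimal polynomial `r`. -/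
theorem minpoly_aeval_root {K : Type*} [Field K] {r w h : K[X]} (hr : Irreducible r)
    (hrm : r.Monic) [Fact (Irreducible w)] (hdvd : w ∣ r.comp h) :
    minpoly K (aeval (AdjoinRoot.root w) h) = r := by
  refine (minpoly.eq_of_irreducible_of_monic hr ?_ hrm).symm
  rw [← aeval_comp]
  obtain ⟨s, hs⟩ := hdvd
  simp [hs]

theorem natDegree_dvd_of_dvd_comp {K : Type*} [Field K] {r w h : K[X]} (hr : Irreducible r)
    (hrm : r.Monic) (hw : Irreducible w) (hdvd : w ∣ r.comp h) :
    r.natDegree ∣ w.natDegree := by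
  have := Fact.mk hw
  have : FiniteDimensional K (AdjoinRoot w) := (AdjoinRoot.powerBasis hw.ne_zero).finite
  rw [← finrank_adjoinRoot hw.ne_zero, ← minpoly_aeval_root hr hrm hdvd]
  exact minpoly.degree_dvd (.of_finite K _)

theorem IsEvenNonOne.exists_dvd_comp {K : Type*} [Field K] {r h : K[X]} (hr : IsEvenNonOne r)
    (hh : h.Monic) (h0 : h.coeff 0 = 0) (hdeg : h.natDegree ≠ 0) :
    ∃ w, IsEvenNonOne w ∧ w ∣ r.comp h ∧ r.natDegree ∣ w.natDegree := by
  have hm : (r.comp h).Monic := hr.monic.comp hh hdeg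
  have hc : (r.comp h).eval 0 = r.coeff 0 := by
    rw [eval_comp, ← coeff_zero_eq_eval_zero h, h0, coeff_zero_eq_eval_zero]
  have hprod : ((normalizedFactors (r.comp h)).map (eval 0)).prod = r.coeff 0 := by
    rw [← eval_multiset_prod, prod_normalizedFactors_eq, hm.normalize_eq_self]
    exacts [hc, hm.ne_zero]
  have : ∃ w ∈ normalizedFactors (r.comp h), eval 0 w ≠ 1 := by
    by_contra! H
    refine hr.coeff_ne_one (hprod ▸ Multiset.prod_eq_one fun x hx => ?_)
    obtain ⟨w, hw, rfl⟩ := Multiset.mem_map.1 hx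
    exact H w hw
  obtain ⟨w, hw, hw1⟩ := this
  have hwd := dvd_of_mem_normalizedFactors hw
  have hwi := irreducible_of_normalized_factor w hw
  have hd := natDegree_dvd_of_dvd_comp hr.irreducible hr.monic hwi hwd
  refine ⟨w, ⟨?_, hwi, hr.even.trans_dvd hd, fun h => ?_, by rwa [coeff_zero_eq_eval_zero]⟩,
    hwd, hd⟩
  · rw [← normalize_normalized_factor w hw]
    exact monic_normalize hwi.ne_zero
  · obtain ⟨s, hs⟩ := hwd
    refine hr.coeff_ne_zero ?_
    rw [← hc, hs, eval_mul, ← coeff_zero_eq_eval_zero, h, zero_mul]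

open IntermediateField in
theorem IsEvenNonOne.two_mul_natDegree_le {K : Type*} [Field K] [Fintype K] {r w : K[X]}
    (hr : IsEvenNonOne r) (hw : Irreducible w) (hdvd : w ∣ r.comp (X ^ (Fintype.card K - 1))) :
    2 * r.natDegree ≤ w.natDegree := by
  obtain ⟨j, hj⟩ := natDegree_dvd_of_dvd_comp hr.irreducible hr.monic hw hdvd
  have hwpos := hw.natDegree_pos
  suffices j ≠ 1 by
    have : 2 ≤ j := by
      rcases j with _ | _ | j <;> simp_all
    rw [hj, mul_comm]
    gcongr
  rintro rfl
  have := Fact.mk hw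
  have : FiniteDimensional K (AdjoinRoot w) := (AdjoinRoot.powerBasis hw.ne_zero).finite
  have hmin := minpoly_aeval_root hr.irreducible hr.monic hdvd
  set b := aeval (AdjoinRoot.root w) (X ^ (Fintype.card K - 1) : K[X]) with hb
  have hfin : Module.finrank K⟮b⟯ (AdjoinRoot w) = 1 := by
    have h1 := Module.finrank_mul_finrank K K⟮b⟯ (AdjoinRoot w)
    rw [adjoin.finrank (.of_finite K b), hmin, finrank_adjoinRoot hw.ne_zero, hj] at h1
    exact Nat.eq_of_mul_eq_mul_left hr.irreducible.natDegree_pos h1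
  have hn := norm_eq_coeff_zero_minpoly_pow (K := K) b
  rw [hfin, hmin, hr.even.neg_one_pow, one_mul, pow_one] at hn
  simp only [hb, map_pow, aeval_X] at hn
  refine hr.coeff_ne_one (hn ▸ FiniteField.pow_card_sub_one_eq_one _ fun h0 => ?_)
  rw [h0, zero_pow (by have := Fintype.one_lt_card (α := K); omega)] at hn
  exact hr.coeff_ne_zero hn.symm

theorem separable_comp_X_pow_card_sq_sub_X {K : Type*} [Field K] [Fintype K] {t : K[X]}
    (ht : Irreducible t) : (t.comp (X ^ Fintype.card K ^ 2 - X)).Separable := by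
  have hs : t.Separable := PerfectField.separable_of_irreducible ht
  obtain ⟨a, b, hab⟩ := hs
  set L : K[X] := X ^ Fintype.card K ^ 2 - X with hL
  have hder : derivative L = -1 := by simp [hL, derivative_X_pow]
  refine ⟨a.comp L, -(b.comp L), ?_⟩
  have := congrArg (fun P => P.comp L) hab
  simp only [add_comp, mul_comp, one_comp] at this
  rw [derivative_comp, hder]
  linear_combination this

theorem frob_iterate_fixed {K E : Type*} [Field K] [Fintype K] [Field E] [Algebra K E]
    {s : ℕ} {x y : E} (hy : y ^ Fintype.card K ^ s = y) (hxy : x ^ Fintype.card K ^ 2 = x + y) :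
    x ^ Fintype.card K ^ (2 * s * ringChar K) = x := by
  have hq (j : ℕ) (z : E) :
      (FiniteField.frobeniusAlgHom K E ^ j) z = z ^ Fintype.card K ^ j := by
    simp [AlgHom.coe_pow, FiniteField.coe_frobeniusAlgHom, pow_iterate]
  set φ := FiniteField.frobeniusAlgHom K E with hφ
  have hyφ : (φ ^ (2 * s)) y = y := by
    rw [mul_comm, pow_mul, sq, AlgHom.mul_apply, hq s y, hy, hq, hy]
  have hxφ : (φ ^ 2) x = x + y := by rw [hq, hxy]
  obtain ⟨c, hc⟩ : ∃ c, (φ ^ (2 * s)) x = x + c := ⟨_, (add_sub_cancel _ _).symm⟩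
  have hcφ : (φ ^ 2) c = c := by
    have h1 : (φ ^ 2) ((φ ^ (2 * s)) x) = (φ ^ (2 * s)) ((φ ^ 2) x) := by
      rw [← AlgHom.mul_apply, ← AlgHom.mul_apply, ← pow_add, ← pow_add, add_comm]
    rw [hc, hxφ, map_add, map_add, hxφ, hc, hyφ] at h1
    linear_combination h1
  have hcφ' : (φ ^ (2 * s)) c = c := by
    rw [pow_mul, AlgHom.coe_pow]
    exact Function.IsFixedPt.iterate hcφ s
  have hj (j : ℕ) : ((φ ^ (2 * s)) ^ j) x = x + j * c := by
    induction j with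
    | zero => simp
    | succ j ih =>
      rw [pow_succ', AlgHom.mul_apply, ih, map_add, map_mul, hc, hcφ', map_natCast]
      push_cast; ring
  have hp : ((ringChar K : ℕ) : E) = 0 := by
    rw [← map_natCast (algebraMap K E), ringChar.Nat.cast_ringChar, map_zero]
  rw [← hq, pow_mul, hj, hp, zero_mul, add_zero]

theorem exists_monic_irreducible_dvd {K : Type*} [Field K] {P : K[X]} (hP : P.natDegree ≠ 0) :
    ∃ w, w.Monic ∧ Irreducible w ∧ w ∣ P :=
  exists_monic_irreducible_factor P fun h => hP (natDegree_eq_zero_of_isUnit h)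

theorem not_irreducible_comp_X_pow_card_sq_sub_X {K : Type*} [Field K] [Fintype K]
    (hq : 2 < Fintype.card K) {t : K[X]} (ht : Irreducible t) :
    ¬ Irreducible (t.comp (X ^ Fintype.card K ^ 2 - X)) := by
  intro hP
  set q := Fintype.card K with hq'
  have hLdeg : (X ^ q ^ 2 - X : K[X]).natDegree = q ^ 2 :=
    FiniteField.X_pow_card_pow_sub_X_natDegree_eq K two_ne_zero (by omega)
  set L : K[X] := X ^ q ^ 2 - X with hL
  have := Fact.mk hP
  have hx : aeval (aeval (AdjoinRoot.root (t.comp L)) L) t = 0 := by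
    rw [← aeval_comp]; simp
  set x := AdjoinRoot.root (t.comp L) with hxdef
  have hy : (aeval x L) ^ q ^ t.natDegree = aeval x L := by
    obtain ⟨u, hu⟩ := ht.natDegree_dvd_iff_dvd_X_pow_card_pow_sub_X.1 dvd_rfl
    have := congrArg (aeval (aeval x L)) hu
    rw [map_mul, hx, zero_mul, Nat.card_eq_fintype_card] at this
    simpa [sub_eq_zero] using this
  have hfix := frob_iterate_fixed hy (show x ^ q ^ 2 = x + aeval x L by simp [hL])
  have hdvd : t.natDegree * q ^ 2 ∣ 2 * t.natDegree * ringChar K := by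
    rw [← hLdeg, ← natDegree_comp]
    refine hP.natDegree_dvd_of_dvd_X_pow_card_pow_sub_X ?_
    rw [← AdjoinRoot.mk_eq_zero, Nat.card_eq_fintype_card]
    simpa [sub_eq_zero] using hfix
  rw [mul_comm 2, mul_assoc, Nat.mul_dvd_mul_iff_left ht.natDegree_pos] at hdvd
  have hp : ringChar K ∣ q := ringChar.dvd (Nat.cast_card_eq_zero K)
  have hppos : 0 < ringChar K := Nat.pos_of_dvd_of_pos hp (by omega)
  have h1 := Nat.le_of_dvd (by omega) hdvd
  have h2 := Nat.le_of_dvd (by omega) hp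
  nlinarith

theorem exists_two_factors_comp {K : Type*} [Field K] [Fintype K]
    (hq : 2 < Fintype.card K) {t : K[X]} (ht : Irreducible t) :
    ∃ w : Bool → K[X], Function.Injective w ∧ ∀ b, (w b).Monic ∧ Irreducible (w b) ∧
      w b ∣ t.comp (X ^ Fintype.card K ^ 2 - X) := by
  have hnot := not_irreducible_comp_X_pow_card_sq_sub_X hq ht
  have hsq := (separable_comp_X_pow_card_sq_sub_X ht).squarefree
  have hdeg : (t.comp (X ^ Fintype.card K ^ 2 - X)).natDegree ≠ 0 := by
    rw [natDegree_comp, FiniteField.X_pow_card_pow_sub_X_natDegree_eq K two_ne_zero (by omega)]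
    have := ht.natDegree_pos
    positivity
  obtain ⟨w, hwm, hwi, v, hv⟩ := exists_monic_irreducible_dvd hdeg
  have hvu : ¬ IsUnit v := fun hu =>
    hnot (hv ▸ (irreducible_mul_isUnit hu).2 hwi)
  obtain ⟨z, hzm, hzi, hzv⟩ := exists_monic_irreducible_factor v hvu
  have hwz : w ≠ z := by
    rintro rfl
    exact hwi.not_isUnit (hsq w (hv ▸ mul_dvd_mul_left w hzv))
  refine ⟨fun b => cond b w z, ?_, ?_⟩
  · rintro (_ | _) (_ | _) h <;> simp_all
  · rintro (_ | _)
    · exact ⟨hzm, hzi, hv ▸ hzv.mul_left w⟩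
    · exact ⟨hwm, hwi, hv ▸ dvd_mul_right w v⟩

theorem mem_irrFactors {K : Type*} [Field K] {P w : K[X]} (hP : P ≠ 0) :
    w ∈ irrFactors P ↔ w.Monic ∧ Irreducible w ∧ w ∣ P := by
  rw [irrFactors, Multiset.mem_toFinset, mem_normalizedFactors_iff' hP]
  constructor
  · rintro ⟨hi, hn, hd⟩
    exact ⟨hn ▸ monic_normalize hi.ne_zero, hi, hd⟩
  · rintro ⟨hm, hi, hd⟩
    exact ⟨hi, hm.normalize_eq_self, hd⟩

theorem two_mul_Nfac_le {K : Type*} [Field K] {P g : K[X]} (hP : P ≠ 0) (hPg : P.comp g ≠ 0)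
    (hg : ∀ r : K[X], Irreducible r → ∃ w : Bool → K[X], Function.Injective w ∧
      ∀ b, (w b).Monic ∧ Irreducible (w b) ∧ w b ∣ r.comp g) :
    2 * Nfac P ≤ Nfac (P.comp g) := by
  choose! w hw hw' using hg
  have hcard : 2 * Nfac P = (irrFactors P ×ˢ (Finset.univ : Finset Bool)).card := by
    rw [Finset.card_product, Finset.card_univ, Fintype.card_bool, mul_comm, Nfac]
  rw [hcard, Nfac]
  refine Finset.card_le_card_of_injOn (fun x => w x.1 x.2) ?_ ?_
  · rintro ⟨r, b⟩ hr
    obtain ⟨-, hri, u, hu⟩ := (mem_irrFactors hP).1 (Finset.mem_product.1 hr).1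
    obtain ⟨h1, h2, h3⟩ := hw' r hri b
    refine (mem_irrFactors hPg).2 ⟨h1, h2, h3.trans ?_⟩
    rw [hu, mul_comp]
    exact dvd_mul_right _ _
  · rintro ⟨r, b⟩ hr ⟨r', b'⟩ hr' h
    obtain ⟨hrm, hri, -⟩ := (mem_irrFactors hP).1 (Finset.mem_product.1 hr).1
    obtain ⟨hrm', hri', -⟩ := (mem_irrFactors hP).1 (Finset.mem_product.1 hr').1
    replace h : w r b = w r' b' := h
    have hrr : r = r' := by
      by_contra hne
      obtain ⟨a, c, hac⟩ : IsCoprime r r' := (hri.coprime_iff_not_dvd).2 fun hd =>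
        hne (eq_of_monic_of_associated hrm hrm' (hri.associated_of_dvd hri' hd))
      have h1 : w r b ∣ 1 := by
        rw [← one_comp (p := g), ← hac, add_comp, mul_comp, mul_comp]
        exact dvd_add ((hw' r hri b).2.2.mul_left _) (h ▸ (hw' r' hri' b').2.2.mul_left _)
      exact (hw' r hri b).2.1.not_isUnit (isUnit_of_dvd_one h1)
    subst hrr
    rw [hw r hri h]

theorem iterPoly_succ' {K : Type*} [CommSemiring K] (g : K[X]) (n : ℕ) :
    iterPoly g (n + 1) = (iterPoly g n).comp g := by
  induction n with
  | zero => simp [iterPoly]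
  | succ n ih =>
    conv_lhs => rw [iterPoly, ih]
    rw [iterPoly, comp_assoc]

theorem Pn_succ {K : Type*} [CommSemiring K] (f g : K[X]) (n : ℕ) :
    Pn f g (n + 1) = (Pn f g n).comp g := by
  rw [Pn, Pn, iterPoly_succ', comp_assoc]

open IntermediateField in
/-- Composing with a suitable monomial creates an even-degree factor whose constant term is
not `1`, namely the minimal polynomial of a primitive root of a finite extension. -/
theorem exists_isEvenNonOne_dvd_comp_X_pow {K : Type*} [Field K] [Fintype K]
    (hq : 2 < Fintype.card K) {r : K[X]} (hr : Irreducible r) (h0 : r.coeff 0 ≠ 0) :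
    ∃ j ≠ 0, ∃ t, IsEvenNonOne t ∧ t ∣ r.comp (X ^ j) := by
  obtain ⟨p, hp⟩ := CharP.exists K
  have : Fact p.Prime := ⟨CharP.char_is_prime K p⟩
  have : NeZero (r.natDegree * 2) := ⟨by have := hr.natDegree_pos; omega⟩
  let E := FiniteField.Extension K p (r.natDegree * 2)
  have hE : Module.finrank K E = r.natDegree * 2 := FiniteField.finrank_extension K p _
  have := Fact.mk hr
  have : FiniteDimensional K (AdjoinRoot r) := (AdjoinRoot.powerBasis hr.ne_zero).finite
  have : Finite (AdjoinRoot r) := Module.finite_of_finite K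
  obtain ⟨φ⟩ : Nonempty (AdjoinRoot r →ₐ[K] E) := FiniteField.nonempty_algHom_of_finrank_dvd
    (by rw [finrank_adjoinRoot hr.ne_zero, hE]; exact dvd_mul_right _ _)
  set α := φ (AdjoinRoot.root r) with hα
  have hαr : aeval α r = 0 := by
    rw [hα, aeval_algHom_apply]; simp
  have hα0 : α ≠ 0 := by
    intro h
    rw [h, ← coeff_zero_eq_aeval_zero'] at hαr
    exact h0 ((map_eq_zero _).1 hαr)
  obtain ⟨θ, hθ⟩ := IsCyclic.exists_generator (α := Eˣ)
  have hpow (x : E) (hx : x ≠ 0) : ∃ j ≠ 0, (θ : E) ^ j = x := by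
    obtain ⟨j, hj⟩ := (mem_powers_iff_mem_zpowers (x := θ)).2 (hθ (Units.mk0 x hx))
    refine ⟨j + Nat.card Eˣ, by have := Nat.card_pos (α := Eˣ); omega, ?_⟩
    rw [← Units.val_pow_eq_pow_val, pow_add, pow_card_eq_one', mul_one]
    exact congrArg Units.val hj
  have htop : K⟮(θ : E)⟯ = ⊤ := by
    refine eq_top_iff.2 fun x _ => ?_
    rcases eq_or_ne x 0 with rfl | hx
    · exact zero_mem _
    · obtain ⟨j, -, rfl⟩ := hpow x hx
      exact pow_mem (mem_adjoin_simple_self K _) j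
  have hint : IsIntegral K (θ : E) := .of_finite K _
  have hdeg : (minpoly K (θ : E)).natDegree = r.natDegree * 2 := by
    rw [← adjoin.finrank hint, htop, finrank_top', hE]
  have heven : Even (minpoly K (θ : E)).natDegree := by
    rw [hdeg]
    exact even_two.mul_left _
  have hnorm := norm_eq_coeff_zero_minpoly_pow (K := K) (θ : E)
  rw [htop, IntermediateField.finrank_top, heven.neg_one_pow, one_mul, pow_one] at hnorm
  obtain ⟨j, hj, hjα⟩ := hpow α hα0
  refine ⟨j, hj, minpoly K (θ : E), ⟨minpoly.monic hint, minpoly.irreducible hint, heven,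
    ?_, ?_⟩, ?_⟩
  · rw [← hnorm]
    exact Algebra.norm_ne_zero_iff.2 θ.ne_zero
  · rw [← hnorm]
    intro h1
    have hall (y : K) (hy : y ≠ 0) : y = 1 := by
      obtain ⟨x, rfl⟩ := FiniteField.norm_surjective K E y
      obtain ⟨i, -, rfl⟩ := hpow x (Algebra.norm_ne_zero_iff.1 hy)
      rw [map_pow, h1, one_pow]
    have : (Finset.univ : Finset K) ⊆ {0, 1} := fun y _ => by
      rcases eq_or_ne y 0 with rfl | hy
      · simp
      · simp [hall y hy]
    have := (Finset.card_le_card this).trans Finset.card_le_two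
    rw [Finset.card_univ] at this
    omega
  · refine minpoly.dvd K _ ?_
    rw [aeval_comp, map_pow, aeval_X, hjα, hαr]

/-- The property `IsEvenNonOne` passes from `t` to a factor of `t ∘ X ^ (q - 1) ∘ L` of at least
twice the degree. -/
theorem IsEvenNonOne.exists_dvd_comp_two_mul_natDegree_le {K : Type*} [Field K] [Fintype K]
    {t L : K[X]} (hq : 2 < Fintype.card K) (ht : IsEvenNonOne t) (hL : L.Monic)
    (hL0 : L.coeff 0 = 0) (hLdeg : L.natDegree ≠ 0) :
    ∃ w, IsEvenNonOne w ∧ w ∣ (t.comp (X ^ (Fintype.card K - 1))).comp L ∧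
      2 * t.natDegree ≤ w.natDegree := by
  have hq1 : Fintype.card K - 1 ≠ 0 := by omega
  obtain ⟨u, hu, hud, -⟩ := ht.exists_dvd_comp (monic_X_pow (Fintype.card K - 1))
    (by simp [coeff_X_pow, hq1.symm]) (by simpa using hq1)
  obtain ⟨w, hw, hwd, hdvd⟩ := hu.exists_dvd_comp hL hL0 hLdeg
  refine ⟨w, hw, hwd.trans ?_, (ht.two_mul_natDegree_le hu.irreducible hud).trans
    (Nat.le_of_dvd hw.irreducible.natDegree_pos hdvd)⟩
  obtain ⟨v, hv⟩ := hud
  rw [hv, mul_comp]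
  exact dvd_mul_right _ _

theorem comp_dvd_comp {K : Type*} [CommSemiring K] {p r : K[X]} (h : p ∣ r) (g : K[X]) :
    p.comp g ∣ r.comp g := by
  obtain ⟨s, rfl⟩ := h
  rw [mul_comp]
  exact dvd_mul_right _ _

theorem natDegree_le_Mfac {K : Type*} [Field K] {P w : K[X]} (hP : P ≠ 0) (hm : w.Monic)
    (hi : Irreducible w) (hd : w ∣ P) : w.natDegree ≤ Mfac P :=
  Finset.le_sup (f := natDegree) ((mem_irrFactors hP).2 ⟨hm, hi, hd⟩)

theorem stmt9 {K : Type*} [Field K] [Fintype K] (hq : 2 < Fintype.card K)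
    (f F : Polynomial K) (k m : ℕ) (hm : 1 ≤ m)
    (hFmonic : F.Monic) (hFdeg : F.natDegree = m)
    (ha0 : F.coeff 0 ≠ 0) (ha1 : F.coeff 0 ≠ 1)
    (hf : f = X ^ k * F) :
    ∃ g : Polynomial K, 2 ≤ g.natDegree ∧ ∃ c : ℝ, 0 < c ∧ ∀ n : ℕ,
      c * (2 : ℝ) ^ n ≤ (Mfac (Pn f g n) : ℝ) ∧
      c * (2 : ℝ) ^ n ≤ (Nfac (Pn f g n) : ℝ) := by
  obtain ⟨r, hrm, hri, hrF⟩ := exists_monic_irreducible_dvd (P := F) (by omega)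
  have hrf : r ∣ f := hf ▸ hrF.mul_left _
  have hr0 : r.coeff 0 ≠ 0 := by
    obtain ⟨s, rfl⟩ := hrF
    rw [mul_coeff_zero] at ha0
    exact left_ne_zero_of_mul ha0
  obtain ⟨j, hj, t, ht, htr⟩ := exists_isEvenNonOne_dvd_comp_X_pow hq hri hr0
  have hLdeg : (X ^ Fintype.card K ^ 2 - X : K[X]).natDegree = Fintype.card K ^ 2 :=
    FiniteField.X_pow_card_pow_sub_X_natDegree_eq K two_ne_zero (by omega)
  have hq2 : 1 < Fintype.card K ^ 2 := Nat.one_lt_pow two_ne_zero (by omega)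
  have hLmonic : (X ^ Fintype.card K ^ 2 - X : K[X]).Monic :=
    monic_X_pow_sub (by rw [degree_X]; exact_mod_cast hq2)
  have hL0 : (X ^ Fintype.card K ^ 2 - X : K[X]).coeff 0 = 0 := by
    simp [coeff_X_pow, (zero_lt_one.trans hq2).ne]
  have hcomp := fun s : K[X] => exists_two_factors_comp hq (t := s)
  set L : K[X] := X ^ Fintype.card K ^ 2 - X with hL
  have hLdeg0 : L.natDegree ≠ 0 := by omega
  set A : K[X] := X ^ (Fintype.card K - 1) with hA
  have hAdeg : A.natDegree = Fintype.card K - 1 := natDegree_X_pow _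
  have hfmonic : f.Monic := hf ▸ (monic_X_pow k).mul hFmonic
  set g : K[X] := ((X ^ j).comp A).comp L with hg
  have hgdeg : g.natDegree = j * (Fintype.card K - 1) * Fintype.card K ^ 2 := by
    rw [hg, natDegree_comp, natDegree_comp, natDegree_X_pow, hAdeg, hLdeg]
  have hj1 : 1 ≤ j * (Fintype.card K - 1) :=
    Nat.one_le_iff_ne_zero.2 (mul_ne_zero hj (by omega))
  have hg2 : 2 ≤ g.natDegree := by rw [hgdeg]; nlinarith
  have hgmonic : g.Monic :=
    ((monic_X_pow j).comp (monic_X_pow _) (by rw [hAdeg]; omega)).comp hLmonic hLdeg0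
  have hPmonic (n : ℕ) : (Pn f g n).Monic := by
    induction n with
    | zero => simpa [Pn, iterPoly] using hfmonic
    | succ n ih => rw [Pn_succ]; exact ih.comp hgmonic (by omega)
  have hbase : 1 ≤ r.natDegree := hri.natDegree_pos
  have hP0 : Pn f g 0 = f := by simp [Pn, iterPoly]
  have hsplit (s : K[X]) : s.comp g = ((s.comp (X ^ j)).comp A).comp L := by
    rw [hg, comp_assoc, comp_assoc, comp_assoc]
  have hM (n : ℕ) : ∃ w, IsEvenNonOne w ∧ w ∣ Pn f g (n + 1) ∧ 2 ^ (n + 1) ≤ w.natDegree := by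
    induction n with
    | zero =>
      obtain ⟨w, hw, hwd, hdeg⟩ :=
        ht.exists_dvd_comp_two_mul_natDegree_le hq hLmonic hL0 hLdeg0
      refine ⟨w, hw, ?_, ?_⟩
      · rw [Pn_succ, hP0]
        refine (hwd.trans ?_).trans (comp_dvd_comp hrf g)
        rw [hsplit]
        exact comp_dvd_comp (comp_dvd_comp htr _) _
      · have := ht.irreducible.natDegree_pos
        omega
    | succ n ih =>
      obtain ⟨s, hs, hsd, hsdeg⟩ := ih
      obtain ⟨u, hu, hud, hudeg⟩ := hs.exists_dvd_comp (monic_X_pow j)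
        (by simp [coeff_X_pow, hj.symm]) (by simpa using hj)
      obtain ⟨w, hw, hwd, hdeg⟩ :=
        hu.exists_dvd_comp_two_mul_natDegree_le hq hLmonic hL0 hLdeg0
      refine ⟨w, hw, ?_, ?_⟩
      · rw [Pn_succ]
        refine (hwd.trans ?_).trans (comp_dvd_comp hsd g)
        rw [hsplit]
        exact comp_dvd_comp (comp_dvd_comp hud _) _
      · have := Nat.le_of_dvd hu.irreducible.natDegree_pos hudeg
        rw [pow_succ]
        omega
  have hMn (n : ℕ) : 2 ^ n ≤ Mfac (Pn f g n) := by
    cases n with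
    | zero => exact hbase.trans (natDegree_le_Mfac (hPmonic 0).ne_zero hrm hri (by rwa [hP0]))
    | succ n =>
      obtain ⟨w, hw, hwd, hdeg⟩ := hM n
      exact hdeg.trans
        (natDegree_le_Mfac (hPmonic (n + 1)).ne_zero hw.monic hw.irreducible hwd)
  have hNn (n : ℕ) : 2 ^ n ≤ Nfac (Pn f g n) := by
    induction n with
    | zero =>
      exact Finset.card_pos.2
        ⟨r, (mem_irrFactors (hPmonic 0).ne_zero).2 ⟨hrm, hri, by rwa [hP0]⟩⟩
    | succ n ih =>
      have hdouble := two_mul_Nfac_le (g := g) (hPmonic n).ne_zero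
        (Pn_succ f g n ▸ (hPmonic (n + 1)).ne_zero) fun s hs => by
          obtain ⟨v, -, hvi, hvd⟩ := exists_monic_irreducible_dvd
            (P := (s.comp (X ^ j)).comp A) (by
              rw [natDegree_comp, natDegree_comp, natDegree_X_pow, hAdeg, mul_assoc]
              exact mul_ne_zero hs.natDegree_pos.ne' (by omega))
          obtain ⟨w, hwinj, hw⟩ := hcomp v hvi
          refine ⟨w, hwinj, fun b => ⟨(hw b).1, (hw b).2.1, (hw b).2.2.trans ?_⟩⟩
          rw [hsplit]
          exact comp_dvd_comp hvd _
      rw [Pn_succ, pow_succ]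
      omega
  refine ⟨g, hg2, 1, one_pos, fun n => ⟨?_, ?_⟩⟩
  · rw [one_mul]; exact_mod_cast hMn n
  · rw [one_mul]; exact_mod_cast hNn n
end

section
/- Let K be a finite field, L a field extension of K of finite degree k, and α ∈ L an element whose minimal polynomial over K has degree k. Let g ∈ K[x] be a polynomial of degree at least one, and let P be a monic irreducible factor over L of the polynomial g(x) − α (where g is viewed in L[x]). Then the subfield of L generated over K by the coefficients of P is all of L; equivalently, the least positive integer s such that all coefficients of P lie in the subfield of L of degree s over K equals k, so that the spin S_K(P) = ∏_{j=0}^{s−1} τ_j(P) has degree k·deg(P), where τ_j raises each coefficient to the power |K|^j. -/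
open Polynomial UniqueFactorizationMonoid
open scoped Classical

/-- If a monic polynomial of positive degree divides `g - C a`, where `g` has coefficients in `R`,
then `a` lies in the `R`-subalgebra generated by the coefficients of that polynomial. -/
theorem Polynomial.Monic.mem_adjoin_coeff_of_dvd_map_sub_C {R S : Type*} [CommRing R] [CommRing S]
    [Algebra R S] {P : Polynomial S} (hP : P.Monic) (hdeg : 0 < P.degree) {g : Polynomial R} {a : S}
    (hdvd : P ∣ g.map (algebraMap R S) - C a) :
    a ∈ Algebra.adjoin R (Set.range P.coeff) := by
  nontriviality S
  set A := Algebra.adjoin R (Set.range P.coeff)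
  have hinj : Function.Injective (algebraMap A S) := Subtype.val_injective
  obtain ⟨Q, hQ⟩ : ∃ Q : Polynomial A, Q.map (algebraMap A S) = P := by
    rw [← mem_lifts, lifts_iff_coeff_lifts]
    exact fun n => ⟨⟨P.coeff n, Algebra.subset_adjoin ⟨n, rfl⟩⟩, rfl⟩
  have hQmonic : Q.Monic := monic_of_injective hinj (hQ.symm ▸ hP)
  have hmod : (g.map (algebraMap R A) %ₘ Q).map (algebraMap A S) = C a := by
    rw [map_modByMonic _ hQmonic, hQ, map_map, ← IsScalarTower.algebraMap_eq,
      ← (modByMonic_eq_self_iff hP).2 (degree_C_le.trans_lt hdeg), ← sub_eq_zero,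
      ← sub_modByMonic, modByMonic_eq_zero_iff_dvd hP]
    exact hdvd
  have hcoeff := congrArg (fun p => p.coeff 0) hmod
  simp only [coeff_map, coeff_C_zero] at hcoeff
  exact hcoeff ▸ Subtype.property _

theorem stmt10 {K L : Type*} [Field K] [Fintype K] [Field L] [Algebra K L]
    [FiniteDimensional K L] (k : ℕ) (hk : Module.finrank K L = k)
    (α : L) (hα : (minpoly K α).natDegree = k)
    (g : Polynomial K) (hg : 1 ≤ g.natDegree)
    (P : Polynomial L) (hPmonic : P.Monic) (hPirr : Irreducible P)
    (hdvd : P ∣ (g.map (algebraMap K L) - C α)) :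
    Algebra.adjoin K (Set.range P.coeff) = ⊤ := by
  have hmem := hPmonic.mem_adjoin_coeff_of_dvd_map_sub_C hPirr.degree_pos hdvd
  have hint : IsIntegral K α := .of_finite K α
  have htop : Algebra.adjoin K {α} = ⊤ := by
    rw [← IntermediateField.adjoin_simple_toSubalgebra_of_isAlgebraic hint.isAlgebraic,
      (Field.primitive_element_iff_minpoly_natDegree_eq K α).2 (hα.trans hk.symm),
      IntermediateField.top_toSubalgebra]
  exact top_le_iff.1 (htop ▸ Algebra.adjoin_le (Set.singleton_subset_iff.2 hmem))
end
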